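/- Let λ, λ' ∈ k^× with λ ≠ λ'. Then every short exact sequence 0 → k_λ → E → k_{λ'} → 0 of left R-modules splits; that is, E ≅ k_λ ⊕ k_{λ'} as left R-modules, with the image of k_λ a direct summand of E. -/

import Mathlib

/-!
`R = k⟨x,y⟩/⟨yx − 1⟩` is the associative `k`-algebra generated by `x` and `y`
with the single defining relation `y * x = 1` (the one-sided inverse of `k[x]`).
We realize it as the `RingQuot` of the free algebra on two generators.
-/

noncomputable section

/-- The defining relation `y * x = 1` on the free algebra `k⟨x,y⟩`. -/
inductive PreRel (k : Type) [Field k] : FreeAlgebra k (Fin 2) → FreeAlgebra k (Fin 2) → Prop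
  | yx : PreRel k (FreeAlgebra.ι k 1 * FreeAlgebra.ι k 0) 1

/-- `R = k⟨x,y⟩/⟨yx − 1⟩`. -/
abbrev R (k : Type) [Field k] := RingQuot (PreRel k)

/-- The generator `x` of `R`. -/
def Xg (k : Type) [Field k] : R k := RingQuot.mkAlgHom k (PreRel k) (FreeAlgebra.ι k 0)

/-- The generator `y` of `R`. -/
def Yg (k : Type) [Field k] : R k := RingQuot.mkAlgHom k (PreRel k) (FreeAlgebra.ι k 1)

/-- The one-dimensional representation `k_λ` of `R`: `x` acts by multiplication by `λ`
and `y` acts by multiplication by `λ⁻¹`. -/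
def chi (k : Type) [Field k] (l : kˣ) : R k →ₐ[k] k :=
  RingQuot.liftAlgHom k ⟨FreeAlgebra.lift k ![(l : k), ((l⁻¹ : kˣ) : k)], by
    rintro a b ⟨⟩
    simp [map_mul]⟩

theorem chi_Xg (k : Type) [Field k] (l : kˣ) : chi k l (Xg k) = l := by
  simp [chi, Xg]

theorem chi_Yg (k : Type) [Field k] (l : kˣ) : chi k l (Yg k) = ((l⁻¹ : kˣ) : k) := by
  simp [chi, Yg]

theorem Yg_mul_Xg (k : Type) [Field k] : Yg k * Xg k = 1 := by
  unfold Yg Xg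
  rw [← map_mul, RingQuot.mkAlgHom_rel k PreRel.yx, map_one]

theorem smul_eigen (k : Type) [Field k] (l : kˣ)
    (E : Type) [AddCommGroup E] [Module (R k) E] (u : E)
    (hx : Xg k • u = algebraMap k (R k) (l : k) • u) (r : R k) :
    r • u = algebraMap k (R k) (chi k l r) • u := by
  have hy : Yg k • u = algebraMap k (R k) ((l⁻¹ : kˣ) : k) • u := by
    have h1 : u = algebraMap k (R k) (l : k) • Yg k • u := by
      rw [← mul_smul, Algebra.commutes, mul_smul, ← hx, ← mul_smul, Yg_mul_Xg, one_smul]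
    conv_rhs => rw [h1]
    rw [← mul_smul, ← map_mul]
    simp
  obtain ⟨a, rfl⟩ := RingQuot.mkAlgHom_surjective k (PreRel k) r
  induction a using FreeAlgebra.induction with
  | grade0 c => rw [AlgHom.commutes, AlgHom.commutes]; rfl
  | grade1 i =>
    fin_cases i
    · change Xg k • u = algebraMap k (R k) (chi k l (Xg k)) • u
      rw [chi_Xg, hx]
    · change Yg k • u = algebraMap k (R k) (chi k l (Yg k)) • u
      rw [chi_Yg, hy]
  | mul a b ha hb =>
    rw [map_mul, mul_smul, hb, ← mul_smul, ← Algebra.commutes, mul_smul, ha, ← mul_smul,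
      ← map_mul, map_mul (chi k l), mul_comm]
  | add a b ha hb => rw [map_add, add_smul, ha, hb, map_add (chi k l), map_add, add_smul]

/-- for `λ ≠ λ'` in `k^×`, every short exact sequence
`0 → k_λ → E → k_{λ'} → 0` of left `R`-modules splits: there is an `R`-equivariant
section of `E → k_{λ'}`, and `E ≅ k_λ ⊕ k_{λ'}` with the image of `k_λ` a direct
summand. -/
theorem ses_of_distinct_characters_splits (k : Type) [Field k] [IsAlgClosed k] [CharZero k]
    (l l' : kˣ) (hll' : l ≠ l')
    (E : Type) [AddCommGroup E] [Module (R k) E]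
    (f : k →+ E) (g : E →+ k)
    (hf : ∀ (r : R k) (c : k), f (chi k l r * c) = r • f c)
    (hg : ∀ (r : R k) (e : E), g (r • e) = chi k l' r * g e)
    (hinj : Function.Injective f) (hsurj : Function.Surjective g)
    (hexact : ∀ e : E, g e = 0 ↔ ∃ c : k, f c = e) :
    (∃ h : k →+ E, (∀ (r : R k) (c : k), h (chi k l' r * c) = r • h c) ∧
      ∀ c : k, g (h c) = c) ∧
    (∃ φ : (k × k) ≃+ E,
      (∀ (r : R k) (p : k × k), φ (chi k l r * p.1, chi k l' r * p.2) = r • φ p) ∧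
      ∀ c : k, φ (c, 0) = f c) := by
  have hne : (l' : k) - l ≠ 0 := sub_ne_zero.mpr fun h => hll' (Units.ext h.symm)
  have hgs : ∀ (c : k) (e : E), g (algebraMap k (R k) c • e) = c * g e := by
    intro c e
    rw [hg, AlgHom.commutes]; rfl
  obtain ⟨e, he⟩ := hsurj 1
  obtain ⟨u, hu, hxu⟩ : ∃ u : E, g u = 1 ∧ Xg k • u = algebraMap k (R k) (l' : k) • u := by
    refine ⟨algebraMap k (R k) ((l' : k) - l)⁻¹ • (Xg k • e - algebraMap k (R k) (l : k) • e),
      ?_, ?_⟩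
    · rw [hgs, map_sub, hg, hgs, chi_Xg, he, mul_one, mul_one, inv_mul_cancel₀ hne]
    · obtain ⟨c, hc⟩ := (hexact (Xg k • e - algebraMap k (R k) (l' : k) • e)).1 (by
        rw [map_sub, hg, hgs, chi_Xg, sub_self])
      have h1 : Xg k • f c = algebraMap k (R k) (l : k) • f c := by
        rw [← hf, ← hf, chi_Xg, AlgHom.commutes]; rfl
      rw [hc] at h1
      have h2 : Xg k • (Xg k • e - algebraMap k (R k) (l : k) • e)
          = algebraMap k (R k) (l' : k) • (Xg k • e - algebraMap k (R k) (l : k) • e) := by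
        have c1 := Algebra.commutes (l : k) (Xg k)
        have c2 := Algebra.commutes (l' : k) (Xg k)
        have c3 := Algebra.commutes (l : k) (algebraMap k (R k) (l' : k))
        simp only [smul_sub, ← mul_smul] at h1 ⊢
        rw [c1, c3, ← c2] at h1
        rw [sub_eq_iff_eq_add] at h1
        rw [h1]; abel
      rw [← mul_smul, ← Algebra.commutes, mul_smul, h2, ← mul_smul, ← mul_smul, Algebra.commutes]
  have hr := smul_eigen k l' E u hxu
  let h : k →+ E :=
    { toFun := fun c => algebraMap k (R k) c • u
      map_zero' := by simp
      map_add' := fun a b => by rw [map_add, add_smul] }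
  have hdef : ∀ c, h c = algebraMap k (R k) c • u := fun _ => rfl
  have hh : ∀ (r : R k) (c : k), h (chi k l' r * c) = r • h c := by
    intro r c
    rw [hdef, hdef, ← mul_smul, hr (r * _), map_mul (chi k l'), AlgHom.commutes]; rfl
  have hgh : ∀ c, g (h c) = c := fun c => by rw [hdef, hgs, hu, mul_one]
  have hgf : ∀ c, g (f c) = 0 := fun c => (hexact _).2 ⟨c, rfl⟩
  refine ⟨⟨h, hh, hgh⟩, ?_⟩
  have hbi : Function.Injective (f.coprod h) := by
    rw [injective_iff_map_eq_zero]
    rintro ⟨a, b⟩ hab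
    rw [AddMonoidHom.coprod_apply] at hab
    have hb : b = 0 := by
      have := congrArg g hab
      simpa [hgf, hgh] using this
    subst hb
    rw [map_zero, add_zero] at hab
    rw [(injective_iff_map_eq_zero f).1 hinj a hab]; rfl
  have hbs : Function.Surjective (f.coprod h) := by
    intro w
    obtain ⟨c, hc⟩ := (hexact (w - h (g w))).1 (by rw [map_sub, hgh, sub_self])
    exact ⟨(c, g w), by rw [AddMonoidHom.coprod_apply]; simp [hc]⟩
  refine ⟨AddEquiv.ofBijective (f.coprod h) ⟨hbi, hbs⟩, ?_, ?_⟩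
  · intro r p
    change f (chi k l r * p.1) + h (chi k l' r * p.2) = r • (f p.1 + h p.2)
    rw [hf, hh, smul_add]
  · intro c
    change f c + h 0 = f c
    rw [map_zero, add_zero]
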